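/- (Local uniqueness of the low-rank projection / prox-regularity of M_{≤r}) Let A ∈ ℝ^{m×n} with rank(A) = r. Then there exists ε > 0 such that every X ∈ ℝ^{m×n} with ‖X − A‖_F < ε has a unique best approximation in M_{≤r} = {Y ∈ ℝ^{m×n} : rank(Y) ≤ r}; i.e., there is exactly one Y ∈ M_{≤r} with ‖X − Y‖_F = min{‖X − Z‖_F : Z ∈ M_{≤r}}. -/

import Mathlib

/-- The Frobenius norm of a real matrix. -/
noncomputable def mfrob {m n : Type*} [Fintype m] [Fintype n] (X : Matrix m n ℝ) : ℝ :=
  Real.sqrt (∑ i, ∑ j, (X i j) ^ 2)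

section LowRankHelpers

attribute [local instance] Matrix.frobeniusNormedAddCommGroup Matrix.frobeniusNormedSpace
  Matrix.frobeniusNormedRing Matrix.frobeniusNormedAlgebra

/-- Frobenius inner product. -/
noncomputable def lrIp {m n : ℕ} (X Y : Matrix (Fin m) (Fin n) ℝ) : ℝ :=
  ∑ i, ∑ j, X i j * Y i j

lemma lrIp_add_right {m n : ℕ} (X Y Z : Matrix (Fin m) (Fin n) ℝ) :
    lrIp X (Y + Z) = lrIp X Y + lrIp X Z := by
  simp [lrIp, mul_add, Finset.sum_add_distrib]

lemma lrIp_sub_right {m n : ℕ} (X Y Z : Matrix (Fin m) (Fin n) ℝ) :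
    lrIp X (Y - Z) = lrIp X Y - lrIp X Z := by
  simp [lrIp, mul_sub, Finset.sum_sub_distrib]

lemma lrIp_smul_right {m n : ℕ} (X Y : Matrix (Fin m) (Fin n) ℝ) (t : ℝ) :
    lrIp X (t • Y) = t * lrIp X Y := by
  simp only [lrIp, Matrix.smul_apply, smul_eq_mul, Finset.mul_sum]
  refine Finset.sum_congr rfl fun i _ => Finset.sum_congr rfl fun j _ => by ring

lemma lrIp_comm {m n : ℕ} (X Y : Matrix (Fin m) (Fin n) ℝ) : lrIp X Y = lrIp Y X := by
  simp [lrIp, mul_comm]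

lemma lr_mfrob_eq {m n : ℕ} (X : Matrix (Fin m) (Fin n) ℝ) : mfrob X = ‖X‖ := by
  rw [Matrix.frobenius_norm_def, mfrob, Real.sqrt_eq_rpow]
  simp

lemma lr_norm_sq {m n : ℕ} (X : Matrix (Fin m) (Fin n) ℝ) : ‖X‖ ^ 2 = lrIp X X := by
  rw [← lr_mfrob_eq, mfrob, Real.sq_sqrt (by positivity)]
  simp [lrIp, sq]

lemma lrIp_le {m n : ℕ} (X Y : Matrix (Fin m) (Fin n) ℝ) : lrIp X Y ≤ ‖X‖ * ‖Y‖ := by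
  refine le_of_abs_le (abs_le_of_sq_le_sq ?_ (by positivity))
  rw [mul_pow, lr_norm_sq, lr_norm_sq]
  simp only [lrIp, ← Finset.sum_product', ← sq]
  exact Finset.sum_mul_sq_le_sq_mul_sq _ (fun p : Fin m × Fin n => X p.1 p.2) (fun p => Y p.1 p.2)

lemma lr_first_order {m n : ℕ} (R K : Matrix (Fin m) (Fin n) ℝ)
    (h : ∀ t : ℝ, ‖R‖ ≤ ‖R - t • K‖) : lrIp R K = 0 := by
  have key : ∀ t : ℝ, 0 ≤ t ^ 2 * lrIp K K - 2 * t * lrIp R K := by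
    intro t
    have h1 := pow_le_pow_left₀ (norm_nonneg _) (h t) 2
    have h2 : lrIp (R - t • K) (R - t • K) = lrIp R R - 2 * t * lrIp R K + t ^ 2 * lrIp K K := by
      rw [lrIp_sub_right, lrIp_smul_right, lrIp_comm _ R, lrIp_comm _ K, lrIp_sub_right,
        lrIp_sub_right, lrIp_smul_right, lrIp_smul_right, lrIp_comm K R]
      ring
    rw [lr_norm_sq, lr_norm_sq, h2] at h1
    linarith
  have hK : 0 ≤ lrIp K K := by rw [← lr_norm_sq]; positivity
  set b := lrIp R K
  set a := lrIp K K
  have h1 := key (b / (a + 1))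
  have ha : 0 < a + 1 := by linarith
  have h2 : (b / (a + 1)) ^ 2 * a - 2 * (b / (a + 1)) * b = - (b ^ 2 * (a + 2) / (a + 1) ^ 2) := by
    field_simp
    ring
  rw [h2] at h1
  by_contra hb
  have : 0 < b ^ 2 * (a + 2) / (a + 1) ^ 2 := by positivity
  linarith

lemma lr_exists_reflexive {m n : ℕ} (A : Matrix (Fin m) (Fin n) ℝ) :
    ∃ G : Matrix (Fin n) (Fin m) ℝ, A * G * A = A ∧ G * A * G = G := by
  let f := Matrix.toLin' A
  obtain ⟨h, hh⟩ := f.rangeRestrict.exists_rightInverse_of_surjective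
    (LinearMap.range_rangeRestrict f)
  obtain ⟨g, hg⟩ := LinearMap.exists_extend h
  have hfg : f ∘ₗ g ∘ₗ f = f := by
    ext1 x
    ext1
    have h1 : g (f (Pi.single x 1)) = h (f.rangeRestrict (Pi.single x 1)) := by
      rw [← hg]; rfl
    have h2 := congrArg Subtype.val (LinearMap.congr_fun hh (f.rangeRestrict (Pi.single x 1)))
    simp only [LinearMap.comp_apply, LinearMap.coe_single]
    rw [h1]
    exact h2
  have hB : A * LinearMap.toMatrix' g * A = A := by
    apply Matrix.toLin'.injective
    rw [Matrix.toLin'_mul, Matrix.toLin'_mul, Matrix.toLin'_toMatrix']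
    exact hfg
  set B := LinearMap.toMatrix' g
  refine ⟨B * A * B, ?_, ?_⟩
  · calc A * (B * A * B) * A = (A * B * A) * B * A := by simp only [Matrix.mul_assoc]
      _ = A := by rw [hB, hB]
  · calc B * A * B * A * (B * A * B) = B * (A * B * A) * B * A * B := by
          simp only [Matrix.mul_assoc]
      _ = B * (A * B * A) * B := by rw [hB, Matrix.mul_assoc B A B, Matrix.mul_assoc B (A * B) A, hB, Matrix.mul_assoc]
      _ = _ := by rw [hB]

lemma lr_inner_inverse {m n : ℕ} (Y : Matrix (Fin m) (Fin n) ℝ) (G : Matrix (Fin n) (Fin m) ℝ)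
    (h : G * Y * G = G) (hr : Y.rank ≤ G.rank) : Y * G * Y = Y := by
  have h1 : G.rank ≤ (Y * G).rank := by
    conv_lhs => rw [← h, Matrix.mul_assoc]
    exact Matrix.rank_mul_le_right _ _
  have hle : LinearMap.range (Y * G).mulVecLin ≤ LinearMap.range Y.mulVecLin := by
    rw [Matrix.mulVecLin_mul]
    exact LinearMap.range_comp_le_range _ _
  have heq := Submodule.eq_of_le_of_finrank_le hle (hr.trans h1)
  apply Matrix.toLin'.injective
  refine LinearMap.ext fun v => ?_
  rw [Matrix.toLin'_apply, Matrix.toLin'_apply]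
  have hv : Y.mulVecLin v ∈ LinearMap.range (Y * G).mulVecLin := by
    rw [heq]; exact ⟨v, rfl⟩
  obtain ⟨w, hw⟩ := hv
  simp only [Matrix.mulVecLin_apply] at hw
  rw [← Matrix.mulVec_mulVec, ← hw, Matrix.mulVec_mulVec]
  congr 1
  calc Y * G * (Y * G) = Y * (G * Y * G) := by simp only [Matrix.mul_assoc]
    _ = _ := by rw [h]

lemma lr_bounded_inverse {m n : ℕ} (A : Matrix (Fin m) (Fin n) ℝ) (H : Matrix (Fin n) (Fin m) ℝ)
    (h1 : A * H * A = A) (h2 : H * A * H = H) (Y : Matrix (Fin m) (Fin n) ℝ)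
    (hr : Y.rank ≤ A.rank) (hY : ‖Y - A‖ * ‖H‖ ≤ 1 / 2) :
    ∃ G : Matrix (Fin n) (Fin m) ℝ, Y * G * Y = Y ∧ ‖G‖ ≤ 2 * ‖H‖ := by
  have : CompleteSpace (Matrix (Fin m) (Fin m) ℝ) := FiniteDimensional.complete ℝ _
  have hE : ‖(Y - A) * H‖ ≤ 1 / 2 := (Matrix.frobenius_norm_mul _ _).trans hY
  have hu : IsUnit (1 - -((Y - A) * H)) := by
    apply isUnit_one_sub_of_norm_lt_one
    rw [norm_neg]; linarith
  rw [sub_neg_eq_add] at hu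
  obtain ⟨W, hW⟩ := hu
  have hHY : H * Y * H = H * (W : Matrix (Fin m) (Fin m) ℝ) := by
    rw [hW, Matrix.mul_add, Matrix.mul_one, Matrix.sub_mul, Matrix.mul_sub, ← Matrix.mul_assoc,
      ← Matrix.mul_assoc, h2]
    abel
  set V : Matrix (Fin m) (Fin m) ℝ := ((W⁻¹ : (Matrix (Fin m) (Fin m) ℝ)ˣ).val) with hV
  have hWV : (W : Matrix (Fin m) (Fin m) ℝ) * V = 1 := W.mul_inv
  have hVW : V * (W : Matrix (Fin m) (Fin m) ℝ) = 1 := W.inv_mul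
  have hGW : H * V * (W : Matrix (Fin m) (Fin m) ℝ) = H := by
    rw [Matrix.mul_assoc, hVW, Matrix.mul_one]
  refine ⟨H * V, ?_, ?_⟩
  · apply lr_inner_inverse
    ·
      have hs : (1 + H * (Y - A)) * (H * V) = H := by
        have : (1 + H * (Y - A)) * H = H * (W : Matrix (Fin m) (Fin m) ℝ) := by
          rw [hW, Matrix.add_mul, Matrix.mul_add, Matrix.one_mul, Matrix.mul_one, Matrix.mul_assoc]
        rw [← Matrix.mul_assoc, this, Matrix.mul_assoc, hWV, Matrix.mul_one]
      have hE' : ‖H * (Y - A)‖ ≤ 1 / 2 := (Matrix.frobenius_norm_mul _ _).trans (by linarith)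
      have : CompleteSpace (Matrix (Fin n) (Fin n) ℝ) := FiniteDimensional.complete ℝ _
      have hu' : IsUnit (1 - -(H * (Y - A))) := by
        apply isUnit_one_sub_of_norm_lt_one
        rw [norm_neg]; linarith
      rw [sub_neg_eq_add] at hu'
      obtain ⟨W', hW'⟩ := hu'
      set V' : Matrix (Fin n) (Fin n) ℝ :=
        ((W'⁻¹ : (Matrix (Fin n) (Fin n) ℝ)ˣ).val)
      have hVW' : V' * (W' : Matrix (Fin n) (Fin n) ℝ) = 1 := W'.inv_mul
      have hHV : H * V = V' * H := by
        calc H * V = V' * (W' : Matrix (Fin n) (Fin n) ℝ) * (H * V) := by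
              rw [hVW', Matrix.one_mul]
          _ = V' * ((1 + H * (Y - A)) * (H * V)) := by rw [hW', Matrix.mul_assoc]
          _ = V' * H := by rw [hs]
      calc H * V * Y * (H * V) = V' * (H * Y * H) * V := by
            rw [← Matrix.mul_assoc (H * V * Y) H V]
            conv_lhs => rw [hHV]
            simp only [Matrix.mul_assoc]
        _ = V' * H := by
            rw [hHY, Matrix.mul_assoc, Matrix.mul_assoc, hWV, Matrix.mul_one]
        _ = _ := hHV.symm
    · refine hr.trans ?_
      calc A.rank = (A * H * A).rank := by rw [h1]
        _ ≤ (A * H).rank := Matrix.rank_mul_le_left _ _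
        _ ≤ H.rank := Matrix.rank_mul_le_right _ _
        _ = (H * V * (W : Matrix (Fin m) (Fin m) ℝ)).rank := by rw [hGW]
        _ ≤ _ := Matrix.rank_mul_le_left _ _
  · set G := H * V
    have hG : G = H - G * ((Y - A) * H) := by
      rw [hW, Matrix.mul_add, Matrix.mul_one] at hGW
      exact eq_sub_of_add_eq hGW
    have h3 : ‖G‖ ≤ ‖H‖ + ‖G‖ * (1 / 2) := by
      calc ‖G‖ = ‖H - G * ((Y - A) * H)‖ := by rw [← hG]
        _ ≤ ‖H‖ + ‖G * ((Y - A) * H)‖ := norm_sub_le _ _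
        _ ≤ ‖H‖ + ‖G‖ * ‖(Y - A) * H‖ := by gcongr; exact Matrix.frobenius_norm_mul _ _
        _ ≤ _ := by gcongr
    linarith

lemma lr_isClosed (m n r : ℕ) : IsClosed {Y : Matrix (Fin m) (Fin n) ℝ | Y.rank ≤ r} := by
  let Φ : Matrix (Fin m) (Fin n) ℝ →ₗ[ℝ] ((Fin n → ℝ) →L[ℝ] (Fin m → ℝ)) :=
    (Matrix.toLin'.trans LinearMap.toContinuousLinearMap).toLinearMap
  have hc : Continuous Φ := LinearMap.continuous_of_finiteDimensional Φ
  have ho := (isOpen_setOfPred_nat_le_rank (𝕜 := ℝ) (E := Fin n → ℝ) (F := Fin m → ℝ)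
    (r + 1)).preimage hc
  rw [← isOpen_compl_iff]
  convert ho using 1
  ext Y
  have : ((Φ Y : (Fin n → ℝ) →L[ℝ] (Fin m → ℝ)) : (Fin n → ℝ) →ₗ[ℝ] (Fin m → ℝ)).rank
      = (Y.rank : Cardinal) := by
    rw [Matrix.rank, Module.finrank_eq_rank]
    rfl
  simp only [Set.mem_compl_iff, Set.mem_ofPred_eq, Set.mem_preimage, not_le]
  erw [this]
  rw [Nat.cast_le]
  rfl

lemma lr_exists (m n r : ℕ) (X : Matrix (Fin m) (Fin n) ℝ) :
    ∃ Y : Matrix (Fin m) (Fin n) ℝ, Y.rank ≤ r ∧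
      ∀ Z : Matrix (Fin m) (Fin n) ℝ, Z.rank ≤ r → ‖X - Y‖ ≤ ‖X - Z‖ := by
  have : ProperSpace (Matrix (Fin m) (Fin n) ℝ) := FiniteDimensional.proper ℝ _
  obtain ⟨Y, hY, hd⟩ := (lr_isClosed m n r).exists_infDist_eq_dist ⟨0, by simp⟩ X
  refine ⟨Y, hY, fun Z hZ => ?_⟩
  rw [← dist_eq_norm, ← dist_eq_norm, ← hd]
  exact Metric.infDist_le_dist_of_mem hZ

/-- The quadratic (prox-regularity) estimate. -/
lemma lr_quad {m n r : ℕ} (X Y Z : Matrix (Fin m) (Fin n) ℝ) (G : Matrix (Fin n) (Fin m) ℝ)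
    (hY : Y.rank ≤ r)
    (hmin : ∀ Z : Matrix (Fin m) (Fin n) ℝ, Z.rank ≤ r → ‖X - Y‖ ≤ ‖X - Z‖)
    (hG : Z * G * Z = Z) :
    lrIp (X - Y) (Z - Y) ≤ ‖X - Y‖ * (‖G‖ * ‖Z - Y‖ ^ 2) := by
  have hright : ∀ K : Matrix (Fin n) (Fin n) ℝ, lrIp (X - Y) (Y * K) = 0 := by
    intro K
    refine lr_first_order _ _ fun t => ?_
    have := hmin (Y * (1 + t • K)) ((Matrix.rank_mul_le_left _ _).trans hY)
    rwa [Matrix.mul_add, Matrix.mul_one, Matrix.mul_smul, ← sub_sub] at this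
  have hleft : ∀ K : Matrix (Fin m) (Fin m) ℝ, lrIp (X - Y) (K * Y) = 0 := by
    intro K
    refine lr_first_order _ _ fun t => ?_
    have := hmin ((1 + t • K) * Y) ((Matrix.rank_mul_le_right _ _).trans hY)
    rwa [Matrix.add_mul, Matrix.one_mul, Matrix.smul_mul, ← sub_sub] at this
  have hdec : Z - Y = Y * (G * Z) + ((Z - Y) * G) * Y + (Z - Y) * G * (Z - Y)
      - Y * (1 : Matrix (Fin n) (Fin n) ℝ) := by
    conv_lhs => rw [← hG]
    simp only [Matrix.sub_mul, Matrix.mul_sub, Matrix.mul_assoc, Matrix.mul_one]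
    abel
  have : lrIp (X - Y) (Z - Y) = lrIp (X - Y) ((Z - Y) * G * (Z - Y)) := by
    conv_lhs => rw [hdec]
    rw [lrIp_sub_right, lrIp_add_right, lrIp_add_right, hright, hright, hleft]
    ring
  rw [this]
  refine (lrIp_le _ _).trans ?_
  gcongr
  calc ‖(Z - Y) * G * (Z - Y)‖ ≤ ‖(Z - Y) * G‖ * ‖Z - Y‖ := Matrix.frobenius_norm_mul _ _
    _ ≤ (‖Z - Y‖ * ‖G‖) * ‖Z - Y‖ := by gcongr; exact Matrix.frobenius_norm_mul _ _
    _ = _ := by ring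

lemma lr_main (m n r : ℕ)
    (A : Matrix (Fin m) (Fin n) ℝ) (hA : A.rank = r) :
    ∃ ε > (0 : ℝ), ∀ X : Matrix (Fin m) (Fin n) ℝ, ‖X - A‖ < ε →
      ∃! Y : Matrix (Fin m) (Fin n) ℝ, Y.rank ≤ r ∧
        ∀ Z : Matrix (Fin m) (Fin n) ℝ, Z.rank ≤ r → ‖X - Y‖ ≤ ‖X - Z‖ := by
  obtain ⟨H, h1, h2⟩ := lr_exists_reflexive A
  have hc : 0 ≤ ‖H‖ := norm_nonneg _
  set c := ‖H‖ with hcdef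
  set ε : ℝ := 1 / (4 * (c + 1)) with hε
  have hε0 : 0 < ε := by positivity
  have hεc : 4 * ε * (c + 1) = 1 := by rw [hε]; field_simp
  refine ⟨ε, hε0, fun X hX => ?_⟩
  obtain ⟨Y, hY, hYm⟩ := lr_exists m n r X
  have near : ∀ Y : Matrix (Fin m) (Fin n) ℝ,
      (∀ Z : Matrix (Fin m) (Fin n) ℝ, Z.rank ≤ r → ‖X - Y‖ ≤ ‖X - Z‖) → Y.rank ≤ r →
      ‖X - Y‖ ≤ ε ∧ ∃ G : Matrix (Fin n) (Fin m) ℝ, Y * G * Y = Y ∧ ‖G‖ ≤ 2 * c := by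
    intro Y hm hr
    have h3 : ‖X - Y‖ ≤ ε := (hm A hA.le).trans hX.le
    have h4 : ‖Y - A‖ ≤ 2 * ε := by
      calc ‖Y - A‖ = ‖(X - A) - (X - Y)‖ := by congr 1; abel
        _ ≤ ‖X - A‖ + ‖X - Y‖ := norm_sub_le _ _
        _ ≤ _ := by linarith
    refine ⟨h3, lr_bounded_inverse A H h1 h2 Y (hA ▸ hr) ?_⟩
    have : ‖Y - A‖ * c ≤ 2 * ε * c := by gcongr
    nlinarith
  refine ⟨Y, ⟨hY, hYm⟩, ?_⟩
  rintro Z ⟨hZ, hZm⟩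
  obtain ⟨e1, G1, hG1, b1⟩ := near Y hYm hY
  obtain ⟨e2, G2, hG2, b2⟩ := near Z hZm hZ
  have q1 := lr_quad X Y Z G2 hY hYm hG2
  have q2 := lr_quad X Z Y G1 hZ hZm hG1
  rw [norm_sub_rev Y Z] at q2
  have hs : ‖Z - Y‖ ^ 2 = lrIp (X - Y) (Z - Y) + lrIp (X - Z) (Y - Z) := by
    rw [lr_norm_sq]
    simp only [lrIp, ← Finset.sum_add_distrib, Matrix.sub_apply]
    refine Finset.sum_congr rfl fun i _ => Finset.sum_congr rfl fun j _ => by ring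
  have q1' : ‖X - Y‖ * (‖G2‖ * ‖Z - Y‖ ^ 2) ≤ ε * ((2 * c) * ‖Z - Y‖ ^ 2) := by gcongr
  have q2' : ‖X - Z‖ * (‖G1‖ * ‖Z - Y‖ ^ 2) ≤ ε * ((2 * c) * ‖Z - Y‖ ^ 2) := by gcongr
  have hfin : ‖Z - Y‖ ^ 2 * (4 * ε) ≤ 0 := by
    have : 4 * ε = 1 - 4 * ε * c := by linarith
    rw [this]; nlinarith
  have hz : ‖Z - Y‖ ^ 2 ≤ 0 := by
    by_contra hcon
    push Not at hcon
    have : 0 < ‖Z - Y‖ ^ 2 * (4 * ε) := by positivity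
    linarith
  have hz' : ‖Z - Y‖ = 0 := by
    have := sq_nonneg ‖Z - Y‖
    exact pow_eq_zero_iff (two_ne_zero) |>.1 (le_antisymm hz this)
  exact sub_eq_zero.1 (norm_eq_zero.1 hz')

end LowRankHelpers

/-- **Local uniqueness of the low-rank projection (prox-regularity of `M_{≤r}`).**
Let `A` be a real `m × n` matrix with `rank A = r`.  Then there is `ε > 0` such that every
`X` with `‖X - A‖_F < ε` has a unique best approximation in
`M_{≤r} = {Y : rank Y ≤ r}`: exactly one `Y` of rank at most `r` minimizes `‖X - Y‖_F` over
all matrices of rank at most `r`. -/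
theorem lowrank_projection_locally_unique (m n r : ℕ)
    (A : Matrix (Fin m) (Fin n) ℝ) (hA : A.rank = r) :
    ∃ ε > (0 : ℝ), ∀ X : Matrix (Fin m) (Fin n) ℝ, mfrob (X - A) < ε →
      ∃! Y : Matrix (Fin m) (Fin n) ℝ, Y.rank ≤ r ∧
        ∀ Z : Matrix (Fin m) (Fin n) ℝ, Z.rank ≤ r → mfrob (X - Y) ≤ mfrob (X - Z) := by
  simp only [lr_mfrob_eq]
  exact lr_main m n r A hA
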